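/- (Multiple Addition Theorem) Let A' be a free hyperplane arrangement in an ℓ-dimensional vector space with exponents d₁ ≤ ⋯ ≤ d_ℓ, where p is the multiplicity of the highest exponent d := d_ℓ (so d_{ℓ−p} < d_{ℓ−p+1} = ⋯ = d_ℓ = d). Let H₁, …, H_q be hyperplanes not in A' such that: (1) X := H₁ ∩ ⋯ ∩ H_q has codimension q; (2) X is not contained in the union of the hyperplanes of A'; (3) |A'| − |(A' ∪ {H_j})^{H_j}| = d for each j, where (A' ∪ {H_j})^{H_j} = {H ∩ H_j : H ∈ A'}. Then q ≤ p and A := A' ∪ {H₁, …, H_q} is free with exponents (d₁, …, d_{ℓ−q}, (d+1)^q). -/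

import Mathlib

open Finset Submodule
open scoped Classical

open MvPolynomial in
/-- The linear form `∑ αᵢ xᵢ` defining the hyperplane with normal vector `α`. -/
noncomputable def linForm {K : Type*} [Field K] {ℓ : ℕ} (α : Fin ℓ → K) :
    MvPolynomial (Fin ℓ) K := ∑ i, MvPolynomial.C (α i) * MvPolynomial.X i

/-- Membership in the module `D(A)` of logarithmic derivations of the
arrangement with defining linear forms `A`: a derivation `θ` (given by its
coordinates `θ i = θ(xᵢ)`) is logarithmic iff `α_H ∣ θ(α_H)` for every
hyperplane `H` of `A`. -/
def memD {K : Type*} [Field K] {ℓ : ℕ} (A : Finset (Fin ℓ → K))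
    (θ : Fin ℓ → MvPolynomial (Fin ℓ) K) : Prop :=
  ∀ α ∈ A, linForm α ∣ ∑ i, MvPolynomial.C (α i) * θ i

/-- The arrangement with defining linear forms `A` is free with exponents `d`:
`D(A)` has a basis `θ 0, …, θ (ℓ-1)` over the polynomial ring, with `θ j`
homogeneous of degree `d j`. -/
def IsFreeWithExp {K : Type*} [Field K] {ℓ : ℕ} (A : Finset (Fin ℓ → K))
    (d : Fin ℓ → ℕ) : Prop :=
  ∃ θ : Fin ℓ → Fin ℓ → MvPolynomial (Fin ℓ) K,
    (∀ j, memD A (θ j)) ∧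
    (∀ j i, (θ j i).IsHomogeneous (d j)) ∧
    (∀ η, memD A η → ∃! c : Fin ℓ → MvPolynomial (Fin ℓ) K,
      η = fun i => ∑ j, c j * θ j i)

/-- The linear functional `v ↦ ∑ αᵢ vᵢ` with coefficient vector `α`. -/
noncomputable def fm {K : Type*} [Field K] {ℓ : ℕ} (α : Fin ℓ → K) :
    (Fin ℓ → K) →ₗ[K] K := ∑ i, α i • LinearMap.proj i

section LinearForms

open MvPolynomial

variable {K : Type*} [Field K] {ℓ : ℕ}

/-- The value `θ(α)` of the derivation with coordinates `θ` on the linear form `α`. -/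
noncomputable def derivForm (α : Fin ℓ → K) (θ : Fin ℓ → MvPolynomial (Fin ℓ) K) :
    MvPolynomial (Fin ℓ) K := ∑ i, C (α i) * θ i

theorem fm_apply (α x : Fin ℓ → K) : fm α x = ∑ i, α i * x i := by
  simp [fm]

theorem linForm_add_smul (a b : K) (α β : Fin ℓ → K) :
    linForm (a • α + b • β) = C a * linForm α + C b * linForm β := by
  simp only [linForm, Finset.mul_sum, ← Finset.sum_add_distrib]
  refine Finset.sum_congr rfl fun i _ => ?_
  simp; ring

theorem derivForm_add_smul (a b : K) (α β : Fin ℓ → K) (θ : Fin ℓ → MvPolynomial (Fin ℓ) K) :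
    derivForm (a • α + b • β) θ = C a * derivForm α θ + C b * derivForm β θ := by
  simp only [derivForm, Finset.mul_sum, ← Finset.sum_add_distrib]
  refine Finset.sum_congr rfl fun i _ => ?_
  simp; ring

theorem linForm_isHomogeneous (α : Fin ℓ → K) : (linForm α).IsHomogeneous 1 :=
  IsHomogeneous.sum _ _ _ fun i _ => isHomogeneous_C_mul_X (α i) i

theorem derivForm_isHomogeneous (α : Fin ℓ → K) {θ : Fin ℓ → MvPolynomial (Fin ℓ) K} {n : ℕ}
    (hθ : ∀ i, (θ i).IsHomogeneous n) : (derivForm α θ).IsHomogeneous n :=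
  IsHomogeneous.sum _ _ _ fun i _ => (hθ i).C_mul (α i)

theorem eval_linForm (α x : Fin ℓ → K) : eval x (linForm α) = fm α x := by
  simp [linForm, fm_apply]

theorem eval_derivForm (α x : Fin ℓ → K) (θ : Fin ℓ → MvPolynomial (Fin ℓ) K) :
    eval x (derivForm α θ) = fm α (fun i => eval x (θ i)) := by
  simp [derivForm, fm_apply]

theorem linForm_injective : Function.Injective (linForm : (Fin ℓ → K) → _) := by
  intro α β h
  funext i
  have := congrArg (coeff (Finsupp.single i 1)) h
  simpa [linForm, coeff_sum, coeff_C_mul, coeff_X, Finsupp.single_left_inj] using this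

theorem linForm_zero : linForm (0 : Fin ℓ → K) = 0 := by
  simp [linForm]

theorem linForm_ne_zero {α : Fin ℓ → K} (hα : α ≠ 0) : linForm α ≠ 0 := fun h =>
  hα (linForm_injective (h.trans linForm_zero.symm))

/-- Projection of coefficient vectors along `α`, killing the coordinate `k`. -/
noncomputable def elimCoord (α : Fin ℓ → K) (k : Fin ℓ) (β : Fin ℓ → K) : Fin ℓ → K :=
  β - (β k / α k) • α

/-- The substitution solving `α = 0` for the variable `k`. -/
noncomputable def restr (α : Fin ℓ → K) (k : Fin ℓ) :
    MvPolynomial (Fin ℓ) K →ₐ[K] MvPolynomial (Fin ℓ) K :=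
  aeval fun i => X i - if i = k then C (α k)⁻¹ * linForm α else 0

theorem restr_isHomogeneous (α : Fin ℓ → K) (k : Fin ℓ) {f : MvPolynomial (Fin ℓ) K} {n : ℕ}
    (hf : f.IsHomogeneous n) : (restr α k f).IsHomogeneous n := by
  have h := hf.aeval (fun i => X i - if i = k then C (α k)⁻¹ * linForm α else 0) (n := 1) (by
    intro i
    refine (isHomogeneous_X K i).sub ?_
    split_ifs
    · exact (linForm_isHomogeneous α).C_mul _
    · exact isHomogeneous_zero _ _ _)
  simpa [restr] using h

theorem restr_linForm (α : Fin ℓ → K) (k : Fin ℓ) (β : Fin ℓ → K) :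
    restr α k (linForm β) = linForm (elimCoord α k β) := by
  have h : elimCoord α k β = (1 : K) • β + (-(β k / α k)) • α := by
    simp [elimCoord, sub_eq_add_neg]
  rw [h, linForm_add_smul]
  conv_lhs => rw [linForm]
  simp only [restr, map_sum, map_mul, algHom_C, aeval_X, mul_sub, Finset.sum_sub_distrib,
    algebraMap_eq]
  simp [linForm, div_eq_mul_inv]
  ring

theorem dvd_sub_restr (α : Fin ℓ → K) (k : Fin ℓ) (f : MvPolynomial (Fin ℓ) K) :
    linForm α ∣ f - restr α k f := by
  induction f using MvPolynomial.induction_on with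
  | C a => simp [restr]
  | add p q hp hq =>
    rw [map_add, add_sub_add_comm]
    exact dvd_add hp hq
  | mul_X p i hp =>
    have hX : linForm α ∣ X i - restr α k (X i) := by
      simp only [restr, aeval_X, sub_sub_cancel]
      split_ifs
      · exact Dvd.intro_left _ rfl
      · exact dvd_zero _
    have h : p * X i - restr α k (p * X i)
        = (p - restr α k p) * X i + restr α k p * (X i - restr α k (X i)) := by
      rw [map_mul]; ring
    rw [h]
    exact dvd_add (hp.mul_right _) (hX.mul_left _)

theorem elimCoord_self {α : Fin ℓ → K} {k : Fin ℓ} (hk : α k ≠ 0) : elimCoord α k α = 0 := by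
  simp [elimCoord, hk]

theorem linForm_dvd_iff {α : Fin ℓ → K} {k : Fin ℓ} (hk : α k ≠ 0)
    (f : MvPolynomial (Fin ℓ) K) : linForm α ∣ f ↔ restr α k f = 0 := by
  constructor
  · rintro ⟨g, rfl⟩
    rw [map_mul, restr_linForm, elimCoord_self hk, linForm_zero, zero_mul]
  · intro h
    simpa [h] using dvd_sub_restr α k f

theorem linForm_prime {α : Fin ℓ → K} (hα : α ≠ 0) : Prime (linForm α) := by
  obtain ⟨k, hk⟩ := Function.ne_iff.mp hα
  refine ⟨linForm_ne_zero hα, fun h => ?_, fun a b h => ?_⟩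
  · have h1 := (linForm_dvd_iff hk 1).1 h.dvd
    simp at h1
  · rw [linForm_dvd_iff hk, map_mul, mul_eq_zero] at h
    rwa [linForm_dvd_iff hk, linForm_dvd_iff hk]

theorem exists_smul_of_linForm_dvd {α β : Fin ℓ → K} (hα : α ≠ 0)
    (h : linForm α ∣ linForm β) : ∃ c : K, β = c • α := by
  obtain ⟨k, hk⟩ := Function.ne_iff.mp hα
  rw [linForm_dvd_iff hk, restr_linForm] at h
  have h0 : elimCoord α k β = 0 := linForm_injective (h.trans linForm_zero.symm)
  exact ⟨_, sub_eq_zero.1 h0⟩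

theorem linForm_isRelPrime {α β : Fin ℓ → K} (hα : α ≠ 0) (h : ∀ c : K, β ≠ c • α) :
    IsRelPrime (linForm α) (linForm β) :=
  (linForm_prime hα).irreducible.isRelPrime_iff_not_dvd.2 fun hd =>
    let ⟨c, hc⟩ := exists_smul_of_linForm_dvd hα hd
    h c hc

theorem fm_injective : Function.Injective (fm : (Fin ℓ → K) → _) := by
  intro α β h
  funext i
  simpa [fm_apply, Pi.single_apply] using congrArg (fun f => f (Pi.single i 1)) h

theorem fm_add_smul (a b : K) (α β : Fin ℓ → K) :
    fm (a • α + b • β) = a • fm α + b • fm β := by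
  ext i
  simp [fm, Pi.single_apply]

/-- A linear form vanishing on the intersection of two hyperplanes is a combination of the
two corresponding forms. -/
theorem exists_combination_of_ker_inf_le {α β γ : Fin ℓ → K}
    (h : LinearMap.ker (fm γ) ⊓ LinearMap.ker (fm α) ≤ LinearMap.ker (fm β)) :
    ∃ a c : K, β = a • γ + c • α := by
  have hs := mem_span_of_iInf_ker_le_ker (L := ![fm γ, fm α]) (K := fm β) (by
    refine le_trans ?_ h
    exact le_inf (iInf_le _ (0 : Fin 2)) (iInf_le _ (1 : Fin 2)))
  simp only [Matrix.range_cons, Matrix.range_empty, Set.union_empty, Set.singleton_union,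
    Submodule.mem_span_pair] at hs
  obtain ⟨a, c, hac⟩ := hs
  exact ⟨a, c, fm_injective (by rw [fm_add_smul, hac])⟩

theorem ker_inf_eq_of_elimCoord_eq_smul {α β γ : Fin ℓ → K} {k : Fin ℓ} {c : K} (hc : c ≠ 0)
    (h : elimCoord α k β = c • elimCoord α k γ) :
    LinearMap.ker (fm β) ⊓ LinearMap.ker (fm α) = LinearMap.ker (fm γ) ⊓ LinearMap.ker (fm α) := by
  have hβ : β = (1 : K) • (c • γ) + (β k / α k - c * (γ k / α k)) • α := by
    funext i
    have := congrFun h i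
    simp [elimCoord] at this ⊢
    linear_combination this
  ext x
  simp only [Submodule.mem_inf, LinearMap.mem_ker]
  refine and_congr_left fun hx => ?_
  have h2 : fm β x = c * fm γ x := by
    conv_lhs => rw [hβ, fm_add_smul]
    have h3 : fm (c • γ) x = c * fm γ x := by
      simp [fm_apply, Finset.mul_sum, mul_assoc]
    simp [hx, h3]
  simp [h2, hc]

end LinearForms

section RestrictionPolynomial

open MvPolynomial

variable {K : Type*} [Field K] {ℓ : ℕ}

theorem ne_smul_symm {α β : Fin ℓ → K} (hβ : β ≠ 0) (h : ∀ c : K, α ≠ c • β) (c : K) :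
    β ≠ c • α := by
  rintro rfl
  have hc : c ≠ 0 := fun hc => hβ (by rw [hc, zero_smul])
  exact h c⁻¹ (by rw [smul_smul, inv_mul_cancel₀ hc, one_smul])

/-- If all forms of `Y` restrict to the same hyperplane of `ker α` as `γ ∈ Y`, then the restriction
of `θ(α)` to `ker α` is divisible by the restrictions of the forms in `Y` other than `γ`. -/
theorem prod_erase_dvd_restr_derivForm {A Y : Finset (Fin ℓ → K)} (hYA : Y ⊆ A)
    (hA0 : ∀ α ∈ A, α ≠ 0)
    (hAnp : ∀ α ∈ A, ∀ β ∈ A, α ≠ β → ∀ c : K, α ≠ c • β)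
    {α : Fin ℓ → K} {k : Fin ℓ} (hk : α k ≠ 0) (hα : ∀ β ∈ A, ∀ c : K, α ≠ c • β)
    {γ : Fin ℓ → K} (hγ : γ ∈ Y)
    (hY : ∀ β ∈ Y, LinearMap.ker (fm γ) ⊓ LinearMap.ker (fm α) ≤ LinearMap.ker (fm β))
    {θ : Fin ℓ → MvPolynomial (Fin ℓ) K} (hθ : memD A θ) :
    ∏ β ∈ Y.erase γ, linForm (elimCoord α k β) ∣ restr α k (derivForm α θ) := by
  have hdvd : ∏ β ∈ Y, linForm β ∣
      linForm α * derivForm γ θ - linForm γ * derivForm α θ := by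
    refine Finset.prod_dvd_of_isRelPrime (fun β hβ β' hβ' hne => ?_) fun β hβ => ?_
    · exact linForm_isRelPrime (hA0 β (hYA hβ)) (hAnp β' (hYA hβ') β (hYA hβ) hne.symm)
    · obtain ⟨a, c, hac⟩ := exists_combination_of_ker_inf_le (hY β hβ)
      have ha : a ≠ 0 := by
        rintro rfl
        rw [zero_smul, zero_add] at hac
        exact ne_smul_symm (hA0 β (hYA hβ)) (hα β (hYA hβ)) c hac
      have hd : linForm β ∣ derivForm β θ := hθ β (hYA hβ)
      have hu : C a⁻¹ * C a = (1 : MvPolynomial (Fin ℓ) K) := by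
        rw [← C_mul, inv_mul_cancel₀ ha, C_1]
      have hl : linForm β = C a * linForm γ + C c * linForm α := by
        rw [hac, linForm_add_smul]
      have hr : derivForm β θ = C a * derivForm γ θ + C c * derivForm α θ := by
        rw [hac, derivForm_add_smul]
      have key : linForm α * derivForm γ θ - linForm γ * derivForm α θ =
          C a⁻¹ * (linForm α * derivForm β θ - linForm β * derivForm α θ) := by
        rw [hl, hr]
        linear_combination
          (-(linForm α * derivForm γ θ - linForm γ * derivForm α θ)) * hu
      rw [key]
      exact Dvd.dvd.mul_left (dvd_sub (hd.mul_left _) (dvd_mul_right _ _)) _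
  have hmap := map_dvd (restr α k) hdvd
  rw [map_sub, map_mul, (linForm_dvd_iff hk _).1 dvd_rfl, zero_mul, zero_sub, dvd_neg, map_mul,
    map_prod, ← Finset.mul_prod_erase _ _ hγ] at hmap
  simp only [restr_linForm] at hmap
  refine (mul_dvd_mul_iff_left ?_).1 hmap
  rw [← restr_linForm, Ne, ← linForm_dvd_iff hk]
  intro h
  obtain ⟨c, hc⟩ := exists_smul_of_linForm_dvd (fun h0 => hk (by simp [h0])) h
  exact ne_smul_symm (hA0 γ (hYA hγ)) (hα γ (hYA hγ)) c hc

/-- There is a polynomial `b`, homogeneous of degree `d = |A| - |A^H|` for `H = ker α`, such that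
`θ(α)` lies in the ideal `(α, b)` for every logarithmic derivation `θ` of `A`.  In particular, if
`θ` is homogeneous of degree at most `d`, then `θ(α)` is a scalar multiple of `b` modulo `α`. -/
theorem exists_restriction_polynomial {A : Finset (Fin ℓ → K)} (hA0 : ∀ α ∈ A, α ≠ 0)
    (hAnp : ∀ α ∈ A, ∀ β ∈ A, α ≠ β → ∀ c : K, α ≠ c • β)
    {α : Fin ℓ → K} (hα0 : α ≠ 0) (hα : ∀ β ∈ A, ∀ c : K, α ≠ c • β) {d : ℕ}
    (hcard : A.card =
      (A.image (fun β => LinearMap.ker (fm β) ⊓ LinearMap.ker (fm α))).card + d) :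
    ∃ b : MvPolynomial (Fin ℓ) K, ∀ (θ : Fin ℓ → MvPolynomial (Fin ℓ) K) (n : ℕ), memD A θ →
      (∀ i, (θ i).IsHomogeneous n) → n ≤ d →
      ∃ c : K, (n < d → c = 0) ∧ linForm α ∣ derivForm α θ - C c * b := by
  obtain ⟨k, hk⟩ := Function.ne_iff.mp hα0
  simp only [Pi.zero_apply] at hk
  set r : (Fin ℓ → K) → Submodule K (Fin ℓ → K) :=
    fun β => LinearMap.ker (fm β) ⊓ LinearMap.ker (fm α) with hr
  have hrep : ∀ Y ∈ A.image r, ∃ γ ∈ A, r γ = Y := fun Y hY => by simpa using hY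
  choose! γ hγA hγ using hrep
  have helim : ∀ β ∈ A, elimCoord α k β ≠ 0 := fun β hβ h0 =>
    ne_smul_symm (hA0 β hβ) (hα β hβ) _ (sub_eq_zero.1 h0)
  set fib : Submodule K (Fin ℓ → K) → Finset (Fin ℓ → K) :=
    fun Y => (A.filter fun β => r β = Y).erase (γ Y) with hfib
  have hfibmem : ∀ Y, ∀ β ∈ fib Y, β ∈ A ∧ r β = Y := fun Y β hβ => by
    simpa using (Finset.mem_filter.1 (Finset.mem_of_mem_erase hβ))
  set b : MvPolynomial (Fin ℓ) K :=
    ∏ Y ∈ A.image r, ∏ β ∈ fib Y, linForm (elimCoord α k β) with hb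
  have hb0 : b ≠ 0 := Finset.prod_ne_zero_iff.2 fun Y _ => Finset.prod_ne_zero_iff.2 fun β hβ =>
    linForm_ne_zero (helim β (hfibmem Y β hβ).1)
  have hdeg : b.IsHomogeneous d := by
    have h1 : b.IsHomogeneous (∑ Y ∈ A.image r, ∑ β ∈ fib Y, 1) :=
      IsHomogeneous.prod _ _ _ fun Y _ => IsHomogeneous.prod _ _ _ fun β _ =>
        linForm_isHomogeneous _
    convert h1
    have h2 : ∀ Y ∈ A.image r, (A.filter fun β => r β = Y).card = (∑ β ∈ fib Y, 1) + 1 := by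
      intro Y hY
      rw [← Finset.card_eq_sum_ones, hfib]
      exact (Finset.card_erase_add_one (by simp [hγA Y hY, hγ Y hY])).symm
    have h3 := Finset.card_eq_sum_card_image r A
    rw [Finset.sum_congr rfl h2, Finset.sum_add_distrib, ← Finset.card_eq_sum_ones] at h3
    omega
  have hdvd : ∀ θ, memD A θ → b ∣ restr α k (derivForm α θ) := by
    intro θ hθ
    refine Finset.prod_dvd_of_isRelPrime (fun Y hY Z hZ hne => ?_) fun Y hY => ?_
    · refine IsRelPrime.prod_left fun β hβ => IsRelPrime.prod_right fun β' hβ' => ?_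
      obtain ⟨hβA, hβY⟩ := hfibmem Y β hβ
      obtain ⟨hβA', hβZ⟩ := hfibmem Z β' hβ'
      refine linForm_isRelPrime (helim β hβA) fun c hc => hne ?_
      have hc0 : c ≠ 0 := by
        rintro rfl
        exact helim β' hβA' (by simpa using hc)
      rw [← hβY, ← hβZ]
      exact (ker_inf_eq_of_elimCoord_eq_smul hc0 hc).symm
    · refine prod_erase_dvd_restr_derivForm (Finset.filter_subset _ _) hA0 hAnp hk hα
        (by simp [hγA Y hY, hγ Y hY]) (fun β hβ => ?_) hθ
      have h4 : r (γ Y) = r β := (hγ Y hY).trans (Finset.mem_filter.1 hβ).2.symm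
      exact h4.le.trans inf_le_left
  refine ⟨b, fun θ n hθ hn hnd => ?_⟩
  obtain ⟨g, hg⟩ := hdvd θ hθ
  have hsub := dvd_sub_restr α k (derivForm α θ)
  rw [hg] at hsub
  by_cases hg0 : g = 0
  · exact ⟨0, fun _ => rfl, by simpa [hg0] using hsub⟩
  have htot : (b * g).totalDegree = n := by
    rw [← hg]
    refine (restr_isHomogeneous α k (derivForm_isHomogeneous α hn)).totalDegree ?_
    rw [hg]
    exact mul_ne_zero hb0 hg0
  rw [totalDegree_mul_of_isDomain hb0 hg0, hdeg.totalDegree hb0] at htot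
  have hgC := totalDegree_eq_zero_iff_eq_C.1 (show g.totalDegree = 0 by omega)
  refine ⟨coeff 0 g, fun h => absurd h (by omega), ?_⟩
  rwa [← hgC, mul_comm]

end RestrictionPolynomial

section LogarithmicBases

open MvPolynomial

variable {K : Type*} [Field K] {ℓ : ℕ} {ι κ : Type*} [Fintype ι] [Fintype κ]

theorem derivForm_sum (α : Fin ℓ → K) (c : ι → MvPolynomial (Fin ℓ) K)
    (θ : ι → Fin ℓ → MvPolynomial (Fin ℓ) K) :
    derivForm α (fun i => ∑ j, c j * θ j i) = ∑ j, c j * derivForm α (θ j) := by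
  simp only [derivForm, Finset.mul_sum]
  rw [Finset.sum_comm]
  exact Finset.sum_congr rfl fun _ _ => Finset.sum_congr rfl fun _ _ => by ring

theorem derivForm_mul (α : Fin ℓ → K) (f : MvPolynomial (Fin ℓ) K)
    (θ : Fin ℓ → MvPolynomial (Fin ℓ) K) :
    derivForm α (fun i => f * θ i) = f * derivForm α θ := by
  simp only [derivForm, Finset.mul_sum]
  exact Finset.sum_congr rfl fun _ _ => by ring

theorem memD_sum {A : Finset (Fin ℓ → K)} (c : ι → MvPolynomial (Fin ℓ) K)
    {θ : ι → Fin ℓ → MvPolynomial (Fin ℓ) K} (hθ : ∀ j, memD A (θ j)) :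
    memD A (fun i => ∑ j, c j * θ j i) := fun α hα => by
  change linForm α ∣ derivForm α _
  rw [derivForm_sum]
  exact Finset.dvd_sum fun j _ => (hθ j α hα).mul_left _

/-- The family `θ` is a basis of the module of logarithmic derivations of `A`. -/
def IsLogBasis (A : Finset (Fin ℓ → K)) (θ : ι → Fin ℓ → MvPolynomial (Fin ℓ) K) : Prop :=
  (∀ j, memD A (θ j)) ∧
    ∀ η, memD A η → ∃! c : ι → MvPolynomial (Fin ℓ) K, η = fun i => ∑ j, c j * θ j i

theorem IsLogBasis.reindex {A : Finset (Fin ℓ → K)} {θ : ι → Fin ℓ → MvPolynomial (Fin ℓ) K}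
    (h : IsLogBasis A θ) (e : κ ≃ ι) : IsLogBasis A (θ ∘ e) := by
  refine ⟨fun j => h.1 _, fun η hη => ?_⟩
  obtain ⟨c, hc, hu⟩ := h.2 η hη
  refine ⟨c ∘ e, ?_, fun c' hc' => ?_⟩
  · rw [hc]
    funext i
    exact (Equiv.sum_comp e fun j => c j * θ j i).symm
  · have := hu (c' ∘ e.symm) (by
      rw [hc']
      funext i
      rw [← Equiv.sum_comp e]
      simp)
    rw [← this]
    funext j
    simp

theorem sum_mul_C_mul_C_of_mul_eq_one [DecidableEq ι] {M : Matrix ι κ K} {N : Matrix κ ι K}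
    (hMN : M * N = 1) (f : ι → MvPolynomial (Fin ℓ) K) (i : ι) :
    ∑ k, (∑ j, f j * C (M j k)) * C (N k i) = f i := by
  simp only [Finset.sum_mul, mul_assoc, ← C_mul]
  rw [Finset.sum_comm]
  simp only [← Finset.mul_sum, ← map_sum, ← Matrix.mul_apply, hMN]
  simp [Matrix.one_apply]

/-- An invertible matrix of scalars transforms a basis into a basis. -/
theorem IsLogBasis.change [DecidableEq ι] [DecidableEq κ] {A : Finset (Fin ℓ → K)}
    {θ : ι → Fin ℓ → MvPolynomial (Fin ℓ) K} (h : IsLogBasis A θ) {G : Matrix κ ι K}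
    {G' : Matrix ι κ K} (hGG' : G * G' = 1) (hG'G : G' * G = 1) :
    IsLogBasis A (fun k i => ∑ j, C (G k j) * θ j i) := by
  refine ⟨fun k => memD_sum _ h.1, fun η hη => ?_⟩
  obtain ⟨c, hc, hu⟩ := h.2 η hη
  have hassoc : ∀ c' : κ → MvPolynomial (Fin ℓ) K,
      (fun i => ∑ k, c' k * ∑ j, C (G k j) * θ j i) =
        fun i => ∑ j, (∑ k, c' k * C (G k j)) * θ j i := by
    intro c'
    funext i
    simp only [Finset.mul_sum, Finset.sum_mul]
    rw [Finset.sum_comm]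
    simp only [mul_assoc]
  refine ⟨fun k => ∑ j, c j * C (G' j k), ?_, fun c' hc' => ?_⟩
  · dsimp only
    rw [hassoc, hc]
    funext i
    exact Finset.sum_congr rfl fun j _ => by rw [sum_mul_C_mul_C_of_mul_eq_one hG'G]
  · have h1 := hu (fun j => ∑ k, c' k * C (G k j)) (by dsimp only; rw [hc', hassoc])
    funext k
    rw [← h1]
    exact (sum_mul_C_mul_C_of_mul_eq_one hGG' c' k).symm

/-- Addition of hyperplanes `α j` to `A`, given a basis of logarithmic derivations of `A` that is
adapted to them. -/
theorem IsLogBasis.addition {q : ℕ} {A : Finset (Fin ℓ → K)} {α : Fin q → Fin ℓ → K}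
    {θ₀ : ι → Fin ℓ → MvPolynomial (Fin ℓ) K} {θ₁ : Fin q → Fin ℓ → MvPolynomial (Fin ℓ) K}
    (h : IsLogBasis A (Sum.elim θ₀ θ₁)) (hα : ∀ j, α j ≠ 0)
    {b : Fin q → MvPolynomial (Fin ℓ) K} (hb : ∀ j, ¬ linForm (α j) ∣ b j)
    (h₀ : ∀ i j, linForm (α j) ∣ derivForm (α j) (θ₀ i))
    (h₁ : ∀ k j, k ≠ j → linForm (α j) ∣ derivForm (α j) (θ₁ k))
    (h₂ : ∀ j, linForm (α j) ∣ derivForm (α j) (θ₁ j) - b j) :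
    IsLogBasis (A ∪ Finset.image α Finset.univ)
      (Sum.elim θ₀ fun j i => linForm (α j) * θ₁ j i) := by
  constructor
  · intro s β hβ
    change linForm β ∣ derivForm β _
    rcases Finset.mem_union.1 hβ with hβ | hβ
    · have h3 : linForm β ∣ derivForm β (Sum.elim θ₀ θ₁ s) := h.1 s β hβ
      rcases s with i | k
      · exact h3
      · simp only [Sum.elim_inr, derivForm_mul]
        exact h3.mul_left _
    · obtain ⟨j, -, rfl⟩ := Finset.mem_image.1 hβ
      rcases s with i | k
      · exact h₀ i j
      · simp only [Sum.elim_inr, derivForm_mul]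
        by_cases hkj : k = j
        · subst hkj
          exact dvd_mul_right _ _
        · exact (h₁ k j hkj).mul_left _
  · intro η hη
    obtain ⟨c, hc, hu⟩ := h.2 η fun β hβ => hη β (Finset.mem_union_left _ hβ)
    have hdvd : ∀ j, linForm (α j) ∣ c (Sum.inr j) := by
      intro j
      have h4 : linForm (α j) ∣ derivForm (α j) η :=
        hη _ (Finset.mem_union_right _ (Finset.mem_image_of_mem _ (Finset.mem_univ j)))
      rw [hc, derivForm_sum, Fintype.sum_sum_type] at h4
      simp only [Sum.elim_inl, Sum.elim_inr] at h4
      rw [dvd_add_right (Finset.dvd_sum fun i _ => (h₀ i j).mul_left _),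
        ← Finset.add_sum_erase _ _ (Finset.mem_univ j),
        dvd_add_left (Finset.dvd_sum fun k hk =>
          (h₁ k j (Finset.ne_of_mem_erase hk)).mul_left _)] at h4
      have h5 : linForm (α j) ∣ c (Sum.inr j) * b j := by
        have := dvd_sub h4 ((h₂ j).mul_left (c (Sum.inr j)))
        rwa [mul_sub, sub_sub_cancel] at this
      exact ((linForm_prime (hα j)).dvd_or_dvd h5).resolve_right (hb j)
    choose g hg using hdvd
    refine ⟨Sum.elim (c ∘ Sum.inl) g, ?_, fun c' hc' => ?_⟩
    · rw [hc]
      funext i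
      simp only [Fintype.sum_sum_type, Sum.elim_inl, Sum.elim_inr, Function.comp_apply, hg]
      congr 1
      exact Finset.sum_congr rfl fun _ _ => by ring
    · have h6 := hu (Sum.elim (c' ∘ Sum.inl) fun j => linForm (α j) * c' (Sum.inr j)) (by
        rw [hc']
        funext i
        simp only [Fintype.sum_sum_type, Sum.elim_inl, Sum.elim_inr, Function.comp_apply]
        congr 1
        exact Finset.sum_congr rfl fun _ _ => by ring)
      funext s
      rcases s with i | j
      · simpa using congrFun h6 (Sum.inl i)
      · have h7 := congrFun h6 (Sum.inr j)
        simp only [Sum.elim_inr, hg] at h7 ⊢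
        exact mul_left_cancel₀ (linForm_ne_zero (hα j)) h7

/-- Away from the hyperplanes of `A`, a basis of logarithmic derivations spans the tangent
space. -/
theorem IsLogBasis.span_eval {A : Finset (Fin ℓ → K)} {θ : ι → Fin ℓ → MvPolynomial (Fin ℓ) K}
    (h : IsLogBasis A θ) {x : Fin ℓ → K} (hx : ∀ β ∈ A, fm β x ≠ 0) :
    Submodule.span K (Set.range fun j i => eval x (θ j i)) = ⊤ := by
  set Q : MvPolynomial (Fin ℓ) K := ∏ β ∈ A, linForm β with hQ
  have hQx : eval x Q ≠ 0 := by
    rw [hQ, map_prod]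
    exact Finset.prod_ne_zero_iff.2 fun β hβ => by rw [eval_linForm]; exact hx β hβ
  rw [eq_top_iff]
  intro v _
  obtain ⟨c, hc, -⟩ := h.2 (fun i => Q * C (v i)) (fun β hβ => by
    change linForm β ∣ derivForm β _
    rw [derivForm_mul]
    exact (Finset.dvd_prod_of_mem _ hβ).mul_right _)
  have hv : v = ∑ j, ((eval x Q)⁻¹ * eval x (c j)) • fun i => eval x (θ j i) := by
    funext i
    have := congrArg (eval x) (congrFun hc i)
    simp only [map_mul, eval_C, map_sum] at this
    simp only [Finset.sum_apply, Pi.smul_apply, smul_eq_mul, mul_assoc, ← Finset.mul_sum, ← this]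
    field_simp
  rw [hv]
  exact Submodule.sum_mem _ fun j _ =>
    Submodule.smul_mem _ _ (Submodule.subset_span ⟨j, rfl⟩)

end LogarithmicBases

section LinearAlgebra

variable {K : Type*} [Field K]

/-- A spanning family of vectors can be transformed by an invertible matrix into zeros followed by
the standard basis. -/
theorem exists_matrix_of_span_eq_top {p q : ℕ} {u : Fin p → Fin q → K}
    (hu : Submodule.span K (Set.range u) = ⊤) :
    ∃ m, m + q = p ∧ ∃ (G : Matrix (Fin m ⊕ Fin q) (Fin p) K)
      (G' : Matrix (Fin p) (Fin m ⊕ Fin q) K), G * G' = 1 ∧ G' * G = 1 ∧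
      ∀ i, ∑ k, G i k • u k = Sum.elim (fun _ => 0) (fun j => Pi.single j 1) i := by
  set T : (Fin p → K) →ₗ[K] (Fin q → K) := Fintype.linearCombination K u with hT
  have hTs : LinearMap.range T = ⊤ := by rw [hT, Fintype.range_linearCombination, hu]
  obtain ⟨s, hs⟩ := T.exists_rightInverse_of_surjective hTs
  have hs' : ∀ y, T (s y) = y := fun y => LinearMap.congr_fun hs y
  have hrank := T.finrank_range_add_finrank_ker
  rw [hTs, finrank_top, Module.finrank_fin_fun, Module.finrank_fin_fun] at hrank
  let e : (LinearMap.ker T × (Fin q → K)) ≃ₗ[K] (Fin p → K) :=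
    LinearEquiv.ofLinearMap ((LinearMap.ker T).subtype.coprod s)
      ((LinearMap.codRestrict (LinearMap.ker T) (LinearMap.id - s ∘ₗ T)
        (fun w => by simp [hs'])).prod T)
      (by ext w : 1; simp)
      (by
        refine LinearMap.ext fun w => ?_
        obtain ⟨⟨w, hw⟩, y⟩ := w
        have hw' : T w = 0 := hw
        simp [hs', hw', Subtype.ext_iff])
  let B : Module.Basis (Fin (Module.finrank K (LinearMap.ker T)) ⊕ Fin q) K (Fin p → K) :=
    ((Module.finBasis K (LinearMap.ker T)).prod (Pi.basisFun K (Fin q))).map e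
  refine ⟨_, by omega, ((Pi.basisFun K (Fin p)).toMatrix B).transpose,
    (B.toMatrix (Pi.basisFun K (Fin p))).transpose, ?_, ?_, ?_⟩
  · rw [← Matrix.transpose_mul, B.toMatrix_mul_toMatrix_flip, Matrix.transpose_one]
  · rw [← Matrix.transpose_mul, Module.Basis.toMatrix_mul_toMatrix_flip, Matrix.transpose_one]
  · intro i
    have h1 : ∑ k, ((Pi.basisFun K (Fin p)).toMatrix B).transpose i k • u k = T (B i) := by
      simp [hT, Fintype.linearCombination_apply, Module.Basis.toMatrix_apply]
    rw [h1]
    rcases i with i | j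
    · simp [B, e]
    · simp [B, e, hs']

end LinearAlgebra

/-- Multiple Addition Theorem.  Hyperplanes are encoded by their
defining linear forms (nonzero, pairwise non-proportional vectors of
coefficients).  `A'` is free with exponents `d 0 ≤ ⋯ ≤ d (ℓ-1)`, whose maximal
value `dmax` occurs with multiplicity `p`; `Hh 0, …, Hh (q-1)` are hyperplanes
not in `A'` such that (1) `X = Hh 0 ∩ ⋯ ∩ Hh (q-1)` has codimension `q`, (2)
`X` is not contained in the union of the hyperplanes of `A'`, and (3)
`|A'| - |(A' ∪ {H_j})^{H_j}| = dmax` for each `j`.  Then `q ≤ p` and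
`A = A' ∪ {Hh 0, …, Hh (q-1)}` is free with exponents
`(d 0, …, d (ℓ-q-1), (dmax+1)^q)`. -/
theorem multiple_addition_theorem {K : Type*} [Field K] {ℓ p q dmax : ℕ}
    (hℓ : 1 ≤ ℓ) (hp1 : 1 ≤ p) (hpl : p ≤ ℓ) (hq1 : 1 ≤ q)
    (A' : Finset (Fin ℓ → K))
    (hA0 : ∀ α ∈ A', α ≠ 0)
    (hAnp : ∀ α ∈ A', ∀ β ∈ A', α ≠ β → ∀ c : K, α ≠ c • β)
    (d : Fin ℓ → ℕ) (hmono : Monotone d)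
    (hdlt : ∀ i : Fin ℓ, (i : ℕ) < ℓ - p → d i < dmax)
    (hdeq : ∀ i : Fin ℓ, ℓ - p ≤ (i : ℕ) → d i = dmax)
    (hfree : IsFreeWithExp A' d)
    (Hh : Fin q → (Fin ℓ → K))
    (hH0 : ∀ j, Hh j ≠ 0)
    (hHnp : ∀ j j' : Fin q, j ≠ j' → ∀ c : K, Hh j ≠ c • Hh j')
    (hnotin : ∀ j, ∀ β ∈ A', ∀ c : K, Hh j ≠ c • β)
    (hcodim : Module.finrank K
        ((Fin ℓ → K) ⧸ (⨅ j, LinearMap.ker (fm (Hh j)))) = q)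
    (hnotsub : ¬ (((⨅ j, LinearMap.ker (fm (Hh j)) : Submodule K (Fin ℓ → K)) :
          Set (Fin ℓ → K)) ⊆
        ⋃ β ∈ (A' : Set (Fin ℓ → K)), (LinearMap.ker (fm β) : Set (Fin ℓ → K))))
    (hrestr : ∀ j : Fin q, A'.card =
        (A'.image (fun β => LinearMap.ker (fm β) ⊓ LinearMap.ker (fm (Hh j)))).card
          + dmax) :
    q ≤ p ∧
      IsFreeWithExp (A' ∪ Finset.image Hh Finset.univ)
        (fun i => if (i : ℕ) < ℓ - q then d i else dmax + 1) := by
  obtain ⟨θ, hθD, hθhom, hθuniq⟩ := hfree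
  have hbasis : IsLogBasis A' θ := ⟨hθD, hθuniq⟩
  obtain ⟨x, hxX, hxA⟩ := Set.not_subset.1 hnotsub
  have hxH : ∀ j, fm (Hh j) x = 0 := by simpa [Submodule.mem_iInf] using hxX
  have hxA' : ∀ β ∈ A', fm β x ≠ 0 := by simpa using hxA
  have hdle : ∀ i, d i ≤ dmax := fun i =>
    (lt_or_ge (i : ℕ) (ℓ - p)).elim (fun h => (hdlt i h).le) fun h => (hdeq i h).le
  choose b hb using fun j =>
    exists_restriction_polynomial hA0 hAnp (hH0 j) (hnotin j) (hrestr j)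
  choose c hc0 hc using fun i j => hb j (θ i) (d i) (hθD i) (hθhom i) (hdle i)
  have heval : ∀ i j, fm (Hh j) (fun k => MvPolynomial.eval x (θ i k)) =
      c i j * MvPolynomial.eval x (b j) := by
    intro i j
    obtain ⟨g, hg⟩ := hc i j
    have := congrArg (MvPolynomial.eval x) hg
    simp only [map_sub, map_mul, MvPolynomial.eval_C, eval_linForm, hxH, zero_mul,
      eval_derivForm] at this
    exact sub_eq_zero.1 this
  have hspan := hbasis.span_eval hxA'
  have hbx : ∀ j, MvPolynomial.eval x (b j) ≠ 0 := by
    intro j hj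
    refine hH0 j (fm_injective ?_)
    have h0 : fm (0 : Fin ℓ → K) = 0 := by simp [fm]
    rw [h0]
    refine LinearMap.ext_on_range hspan fun i => ?_
    rw [heval, hj, mul_zero, LinearMap.zero_apply]
  have hΛ : LinearMap.range (LinearMap.pi fun j => fm (Hh j)) = ⊤ := by
    refine Submodule.eq_top_of_finrank_eq ?_
    rw [← (LinearMap.quotKerEquivRange _).finrank_eq, LinearMap.ker_pi, hcodim,
      Module.finrank_fin_fun]
  have hcspan : Submodule.span K (Set.range c) = ⊤ := by
    rw [eq_top_iff]
    intro y _
    obtain ⟨v, hv⟩ : (fun j => MvPolynomial.eval x (b j) * y j) ∈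
        LinearMap.range (LinearMap.pi fun j => fm (Hh j)) := hΛ ▸ Submodule.mem_top
    have hvs : v ∈ Submodule.span K (Set.range fun i k => MvPolynomial.eval x (θ i k)) :=
      hspan ▸ Submodule.mem_top
    obtain ⟨w, rfl⟩ := (Submodule.mem_span_range_iff_exists_fun K).1 hvs
    refine (Submodule.mem_span_range_iff_exists_fun K).2 ⟨w, funext fun j => ?_⟩
    refine mul_left_cancel₀ (hbx j) ?_
    have h1 := congrFun hv j
    simp only [LinearMap.pi_apply, map_sum, map_smul, heval, smul_eq_mul] at h1
    rw [← h1, Finset.sum_apply, Finset.mul_sum]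
    exact Finset.sum_congr rfl fun i _ => by simp only [Pi.smul_apply, smul_eq_mul]; ring
  obtain ⟨n, rfl⟩ : ∃ n, ℓ = n + p := ⟨ℓ - p, by omega⟩
  have hclow : ∀ i : Fin n, c (Fin.castAdd p i) = 0 := fun i =>
    funext fun j => hc0 _ j (hdlt _ (by simp))
  have hdhigh : ∀ i : Fin p, d (Fin.natAdd n i) = dmax := fun i => hdeq _ (by simp)
  have hcspan' : Submodule.span K (Set.range fun i : Fin p => c (Fin.natAdd n i)) = ⊤ := by
    rw [eq_top_iff, ← hcspan, Submodule.span_le]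
    rintro _ ⟨i, rfl⟩
    induction i using Fin.addCases with
    | left i => rw [hclow]; exact Submodule.zero_mem _
    | right i => exact Submodule.subset_span ⟨i, rfl⟩
  obtain ⟨m, rfl, G, G', hGG', hG'G, hGc⟩ := exists_matrix_of_span_eq_top hcspan'
  refine ⟨Nat.le_add_left q m, ?_⟩
  set φ : Fin m ⊕ Fin q → Fin (n + (m + q)) → MvPolynomial (Fin (n + (m + q))) K :=
    fun s i => ∑ t, MvPolynomial.C (G s t) * θ (Fin.natAdd n t) i with hφ
  have hadapted : IsLogBasis A' (Sum.elim
      (Sum.elim (fun i => θ (Fin.castAdd (m + q) i)) (φ ∘ Sum.inl)) (φ ∘ Sum.inr)) := by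
    convert ((hbasis.reindex finSumFinEquiv).change
      (G := Matrix.fromBlocks (1 : Matrix (Fin n) (Fin n) K) 0 0 G)
      (G' := Matrix.fromBlocks 1 0 0 G')
      (by simp [Matrix.fromBlocks_multiply, hGG'])
      (by simp [Matrix.fromBlocks_multiply, hG'G])).reindex
      (Equiv.sumAssoc (Fin n) (Fin m) (Fin q)) using 1
    funext s i
    rcases s with (s | s) | s <;>
      simp [hφ, Fintype.sum_sum_type, Matrix.one_apply, apply_ite MvPolynomial.C, ite_mul]
  have hφdvd : ∀ s j, linForm (Hh j) ∣ derivForm (Hh j) (φ s) -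
      MvPolynomial.C ((Sum.elim (fun _ => 0) (fun j => Pi.single j 1) s : Fin q → K) j) * b j := by
    intro s j
    rw [← hGc s, hφ, derivForm_sum, Finset.sum_apply, map_sum, Finset.sum_mul,
      ← Finset.sum_sub_distrib]
    refine Finset.dvd_sum fun t _ => ?_
    have := (hc (Fin.natAdd n t) j).mul_left (MvPolynomial.C (G s t))
    rwa [mul_sub, ← mul_assoc, ← MvPolynomial.C_mul] at this
  have hbdvd : ∀ j, ¬ linForm (Hh j) ∣ b j := by
    rintro j ⟨g, hg⟩
    exact hbx j (by rw [hg, map_mul, eval_linForm, hxH, zero_mul])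
  have hlog := hadapted.addition hH0 hbdvd
    (by
      rintro (i | k) j
      · simpa [hclow] using hc (Fin.castAdd (m + q) i) j
      · simpa using hφdvd (Sum.inl k) j)
    (fun k j hkj => by simpa [Pi.single_eq_of_ne' hkj] using hφdvd (Sum.inr k) j)
    (fun j => by simpa using hφdvd (Sum.inr j) j)
  have hφhom : ∀ s i, (φ s i).IsHomogeneous dmax := fun s i =>
    MvPolynomial.IsHomogeneous.sum _ _ _ fun t _ => by
      have := (hθhom (Fin.natAdd n t) i).C_mul (G s t)
      rwa [hdhigh] at this
  let e : (Fin n ⊕ Fin m) ⊕ Fin q ≃ Fin (n + (m + q)) :=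
    (Equiv.sumAssoc _ _ _).trans
      ((Equiv.sumCongr (Equiv.refl _) finSumFinEquiv).trans finSumFinEquiv)
  have hfinal := hlog.reindex e.symm
  refine ⟨_, hfinal.1, fun j => ?_, hfinal.2⟩
  obtain ⟨s, rfl⟩ := e.surjective j
  intro i
  simp only [Function.comp_apply, Equiv.symm_apply_apply]
  rcases s with (s | s) | s
  · have hlt : (s : ℕ) < n + (m + q) - q := by omega
    simpa [e, hlt] using hθhom (Fin.castAdd (m + q) s) i
  · have hlt : n + (s : ℕ) < n + (m + q) - q := by omega
    simpa [e, hlt, hdhigh] using hφhom (Sum.inl s) i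
  · have hlt : ¬ n + (m + (s : ℕ)) < n + (m + q) - q := by omega
    have := (linForm_isHomogeneous (Hh s)).mul (hφhom (Sum.inr s) i)
    simpa [e, hlt, add_comm 1 dmax] using this
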